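/- Let β̂ be a Lasso solution for (X, y, λ), λ > 0, with active set A and subgradient s satisfying the KKT conditions, and assume |s_j| < 1 strictly for all j ∉ A and X_A^T X_A invertible. Then β̂ is the unique Lasso solution, and every Lasso solution has active set contained in A. -/

import Mathlib

open Matrix Finset

/-- KKT characterization of a Lasso solution with a given subgradient `s`. -/
def IsLassoKKT {n p : ℕ} (X : Matrix (Fin n) (Fin p) ℝ) (y : Fin n → ℝ) (lam : ℝ)
    (β s : Fin p → ℝ) : Prop :=
  Xᵀ *ᵥ (X *ᵥ β - y) + lam • s = 0 ∧
    ∀ j, (β j ≠ 0 → s j = Real.sign (β j)) ∧ (β j = 0 → |s j| ≤ 1)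

/-- A Lasso solution is a minimizer of the Lasso objective. -/
def IsLassoSol {n p : ℕ} (X : Matrix (Fin n) (Fin p) ℝ) (y : Fin n → ℝ) (lam : ℝ)
    (β : Fin p → ℝ) : Prop :=
  ∀ γ : Fin p → ℝ,
    (1/2) * ∑ i, (y i - (X *ᵥ β) i)^2 + lam * ∑ j, |β j| ≤
      (1/2) * ∑ i, (y i - (X *ᵥ γ) i)^2 + lam * ∑ j, |γ j|

/-- A KKT subgradient pairs with its vector to give the `ℓ¹` norm, coordinatewise. -/
lemma IsLassoKKT.mul_eq_abs {n p : ℕ} {X : Matrix (Fin n) (Fin p) ℝ} {y : Fin n → ℝ} {lam : ℝ}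
    {β s : Fin p → ℝ} (h : IsLassoKKT X y lam β s) (j : Fin p) : s j * β j = |β j| := by
  by_cases hj : β j = 0
  · simp [hj]
  · rw [(h.2 j).1 hj]
    obtain hneg | hpos := lt_or_gt_of_ne hj
    · rw [Real.sign_of_neg hneg, abs_of_neg hneg, neg_one_mul]
    · rw [Real.sign_of_pos hpos, abs_of_pos hpos, one_mul]

lemma IsLassoKKT.abs_le_one {n p : ℕ} {X : Matrix (Fin n) (Fin p) ℝ} {y : Fin n → ℝ} {lam : ℝ}
    {β s : Fin p → ℝ} (h : IsLassoKKT X y lam β s) (j : Fin p) : |s j| ≤ 1 := by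
  by_cases hj : β j = 0
  · exact (h.2 j).2 hj
  · rw [(h.2 j).1 hj]
    obtain h | h | h := Real.sign_apply_eq (β j) <;> simp [h]

/-- The excess of the Lasso objective over its value at a KKT point. -/
lemma IsLassoKKT.objective_eq {n p : ℕ} {X : Matrix (Fin n) (Fin p) ℝ} {y : Fin n → ℝ} {lam : ℝ}
    {β s : Fin p → ℝ} (h : IsLassoKKT X y lam β s) (γ : Fin p → ℝ) :
    (1/2) * ∑ i, (y i - (X *ᵥ γ) i)^2 + lam * ∑ j, |γ j| =
      (1/2) * ∑ i, (y i - (X *ᵥ β) i)^2 + lam * ∑ j, |β j| +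
        ((1/2) * ∑ i, ((X *ᵥ (γ - β)) i)^2 + lam * ∑ j, (|γ j| - s j * γ j)) := by
  have hcross : ∑ i, (X *ᵥ (γ - β)) i * ((X *ᵥ β) i - y i) =
      -(lam * ∑ j, s j * (γ j - β j)) := by
    have h1 := congrArg (fun v => (γ - β) ⬝ᵥ v) h.1
    simp only [dotProduct_add, dotProduct_zero, dotProduct_mulVec, vecMul_transpose,
      dotProduct_smul, smul_eq_mul] at h1
    simp only [dotProduct, Pi.sub_apply] at h1
    simp only [mul_comm (s _)]
    linarith
  have hsq : ∑ i, (y i - (X *ᵥ γ) i)^2 = ∑ i, (y i - (X *ᵥ β) i)^2 +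
      ∑ i, ((X *ᵥ (γ - β)) i)^2 + 2 * ∑ i, (X *ᵥ (γ - β)) i * ((X *ᵥ β) i - y i) := by
    rw [mul_sum, ← sum_add_distrib, ← sum_add_distrib]
    refine sum_congr rfl fun i _ => ?_
    rw [mulVec_sub, Pi.sub_apply]
    ring
  rw [hsq, hcross]
  simp only [mul_sub, sum_sub_distrib, h.mul_eq_abs]
  ring

/-- Every Lasso solution has the same fitted values as a KKT point, and shares its subgradient. -/
lemma IsLassoKKT.of_isLassoSol {n p : ℕ} {X : Matrix (Fin n) (Fin p) ℝ} {y : Fin n → ℝ} {lam : ℝ}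
    (hlam : 0 < lam) {β s : Fin p → ℝ} (h : IsLassoKKT X y lam β s) {γ : Fin p → ℝ}
    (hγ : IsLassoSol X y lam γ) : X *ᵥ (γ - β) = 0 ∧ ∀ j, |γ j| = s j * γ j := by
  have hle := hγ β
  rw [h.objective_eq γ] at hle
  have hterm : ∀ j, 0 ≤ |γ j| - s j * γ j := fun j => by
    have h1 : s j * γ j ≤ |s j| * |γ j| := (le_abs_self _).trans_eq (abs_mul _ _)
    have h2 := mul_le_mul_of_nonneg_right (h.abs_le_one j) (abs_nonneg (γ j))
    linarith
  have hS : 0 ≤ ∑ i, ((X *ᵥ (γ - β)) i)^2 := sum_nonneg fun i _ => sq_nonneg _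
  have hT : 0 ≤ lam * ∑ j, (|γ j| - s j * γ j) :=
    mul_nonneg hlam.le (sum_nonneg fun j _ => hterm j)
  have hS0 : ∑ i, ((X *ᵥ (γ - β)) i)^2 = 0 := by linarith
  have hT0 : ∑ j, (|γ j| - s j * γ j) = 0 :=
    (mul_eq_zero.mp (by linarith : lam * ∑ j, (|γ j| - s j * γ j) = 0)).resolve_left hlam.ne'
  constructor
  · funext i
    exact pow_eq_zero_iff two_ne_zero |>.mp
      ((sum_eq_zero_iff_of_nonneg fun i _ => sq_nonneg _).mp hS0 i (mem_univ i))
  · intro j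
    exact sub_eq_zero.mp ((sum_eq_zero_iff_of_nonneg fun j _ => hterm j).mp hT0 j (mem_univ j))

/-- If the Gram matrix of the columns in `A` is invertible, the kernel of `X` contains no nonzero
vector supported in `A`. -/
lemma eq_zero_of_mulVec_eq_zero_of_isUnit_gram {m n : Type*} [Fintype m] [Fintype n]
    [DecidableEq n] (X : Matrix m n ℝ) (A : Finset n)
    (hG : IsUnit ((X.submatrix id (fun j : {j // j ∈ A} => (j : n)))ᵀ *
      X.submatrix id (fun j : {j // j ∈ A} => (j : n))))
    {d : n → ℝ} (hd : X *ᵥ d = 0) (hsupp : ∀ j ∉ A, d j = 0) : d = 0 := by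
  set XA := X.submatrix id (fun j : {j // j ∈ A} => (j : n))
  have hXA : XA *ᵥ (fun j => d j) = 0 := by
    rw [← hd]
    funext i
    change ∑ j : {j // j ∈ A}, X i j * d j = ∑ j, X i j * d j
    rw [sum_coe_sort A fun j => X i j * d j]
    exact sum_subset (subset_univ A) fun j _ hj => by rw [hsupp j hj, mul_zero]
  have hdA : (fun j : {j // j ∈ A} => d j) = 0 := by
    apply mulVec_injective_of_isUnit hG
    rw [← mulVec_mulVec, hXA, mulVec_zero, mulVec_zero]
  funext j
  by_cases hj : j ∈ A
  · exact congrFun hdA ⟨j, hj⟩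
  · exact hsupp j hj

/-- under strict dual feasibility `|s_j| < 1` off the active set `A`
and invertibility of `X_A^T X_A`, the Lasso solution `β̂` is unique, and every Lasso
solution has active set contained in `A`. -/
theorem lasso_unique_under_strict_dual_feasibility
    {n p : ℕ} (X : Matrix (Fin n) (Fin p) ℝ) (y : Fin n → ℝ) (lam : ℝ) (hlam : 0 < lam)
    (β s : Fin p → ℝ) (hKKT : IsLassoKKT X y lam β s)
    (A : Finset (Fin p)) (hA : ∀ j, β j ≠ 0 ↔ j ∈ A)
    (hstrict : ∀ j ∉ A, |s j| < 1)
    (XA : Matrix (Fin n) {j // j ∈ A} ℝ)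
    (hXA : XA = X.submatrix id (fun j : {j // j ∈ A} => (j : Fin p)))
    (hG : IsUnit (XAᵀ * XA)) :
    (∀ β' : Fin p → ℝ, IsLassoSol X y lam β' → β' = β) ∧
    (∀ β' : Fin p → ℝ, IsLassoSol X y lam β' → ∀ j, β' j ≠ 0 → j ∈ A) := by
  have hsupp : ∀ γ : Fin p → ℝ, IsLassoSol X y lam γ → ∀ j ∉ A, γ j = 0 := by
    intro γ hγ j hj
    by_contra hne
    have heq := (hKKT.of_isLassoSol hlam hγ).2 j
    have hlt := mul_lt_mul_of_pos_right (hstrict j hj) (abs_pos.mpr hne)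
    rw [← abs_mul, ← heq, abs_abs, one_mul] at hlt
    exact hlt.false
  refine ⟨fun γ hγ => sub_eq_zero.mp ?_, fun γ hγ j => not_imp_comm.mp (hsupp γ hγ j)⟩
  subst hXA
  refine eq_zero_of_mulVec_eq_zero_of_isUnit_gram X A hG (hKKT.of_isLassoSol hlam hγ).1 ?_
  intro j hj
  rw [Pi.sub_apply, hsupp γ hγ j hj, not_not.mp (mt (hA j).mp hj), sub_zero]
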